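/- Let ℓ be the line {x : ⟪x − q, n⟫ = 0} in the Euclidean plane ℝ² (q a point, n a nonzero vector), H = {x : ⟪x − q, n⟫ ≤ 0}, R the orthogonal reflection across ℓ, and F the fold map across ℓ towards H. Let a, b be points with ⟪a − q, n⟫ < 0 and ⟪b − q, n⟫ > 0 (so the fold line crosses the interior of the segment [a,b]), and let p be a point of the segment [a,b] lying on ℓ. Then the image of the segment under the fold satisfies F '' [a,b] = [a,p] ∪ [p, R b]: folding splits the segment into two segments that share the endpoint p on the folded line (a V shape). -/

import Mathlib

open RealInnerProductSpace

/-- A point of a segment splits it into two subsegments. -/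
theorem segment_eq_union_of_mem {E : Type*} [AddCommGroup E] [Module ℝ E] {a b p : E}
    (hp : p ∈ segment ℝ a b) : segment ℝ a b = segment ℝ a p ∪ segment ℝ p b := by
  apply Set.Subset.antisymm
  · rw [segment_eq_image_lineMap] at hp
    obtain ⟨t, ⟨ht0, ht1⟩, rfl⟩ := hp
    intro x hx
    rw [segment_eq_image_lineMap] at hx
    obtain ⟨s, ⟨hs0, hs1⟩, rfl⟩ := hx
    have key (u v : ℝ) : segment ℝ (AffineMap.lineMap a b u : E) (AffineMap.lineMap a b v) =
        AffineMap.lineMap a b '' segment ℝ u v := (image_segment ℝ _ u v).symm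
    rcases le_total s t with h | h
    · left
      have := key 0 t
      rw [AffineMap.lineMap_apply_zero] at this
      rw [this, segment_eq_Icc ht0]
      exact Set.mem_image_of_mem _ ⟨hs0, h⟩
    · right
      have := key t 1
      rw [AffineMap.lineMap_apply_one] at this
      rw [this, segment_eq_Icc ht1]
      exact Set.mem_image_of_mem _ ⟨h, hs1⟩
  · exact Set.union_subset
      ((convex_segment a b).segment_subset (left_mem_segment ℝ a b) hp)
      ((convex_segment a b).segment_subset hp (right_mem_segment ℝ a b))

/-- The reflection across the line through `q` with normal `n`, as an affine map. -/
noncomputable def lineReflection {E : Type*} [NormedAddCommGroup E] [InnerProductSpace ℝ E]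
    (q n : E) : E →ᵃ[ℝ] E where
  toFun x := x - (2 * ⟪x - q, n⟫ / ⟪n, n⟫) • n
  linear :=
    { toFun := fun v => v - (2 * ⟪v, n⟫ / ⟪n, n⟫) • n
      map_add' := fun v w => by rw [inner_add_left]; module
      map_smul' := fun c v => by
        rw [real_inner_smul_left, RingHom.id_apply]; module }
  map_vadd' x v := by
    simp only [vadd_eq_add, LinearMap.coe_mk, AddHom.coe_mk, add_sub_assoc v x q, inner_add_left]
    module

/-- If the fold line `ℓ = {x : ⟪x - q, n⟫ = 0}` crosses the interior of the segment
`[a,b]` (with `a` strictly inside the half-plane `H` and `b` strictly outside),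
and `p` is the point of `[a,b]` on `ℓ`, then folding maps `[a,b]` onto the union
of the two segments `[a,p]` and `[p, R b]`, a V shape meeting at `p`. -/
theorem fold_splits_segment
    (q n : EuclideanSpace ℝ (Fin 2)) (hn : n ≠ 0)
    (R F : EuclideanSpace ℝ (Fin 2) → EuclideanSpace ℝ (Fin 2))
    (hR : ∀ x, R x = x - (2 * ⟪x - q, n⟫ / ⟪n, n⟫) • n)
    (hF : ∀ x, F x = if ⟪x - q, n⟫ ≤ 0 then x else R x)
    (a b p : EuclideanSpace ℝ (Fin 2))
    (ha : ⟪a - q, n⟫ < 0) (hb : 0 < ⟪b - q, n⟫)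
    (hp : p ∈ segment ℝ a b) (hpl : ⟪p - q, n⟫ = 0) :
    F '' segment ℝ a b = segment ℝ a p ∪ segment ℝ p (R b) := by
  have fixed (x) (hx : ⟪x - q, n⟫ = 0) : R x = x := by simp [hR, hx]
  have comb (x y : EuclideanSpace ℝ (Fin 2)) (s t : ℝ) (hst : s + t = 1) :
      ⟪s • x + t • y - q, n⟫ = s * ⟪x - q, n⟫ + t * ⟪y - q, n⟫ := by
    rw [← real_inner_smul_left, ← real_inner_smul_left, ← inner_add_left]
    congr 1
    obtain rfl : s = 1 - t := by linarith
    module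
  have eq_id : Set.EqOn F id (segment ℝ a p) := by
    rintro _ ⟨s, t, hs, ht, hst, rfl⟩
    rw [hF, if_pos, id]
    rw [comb a p s t hst, hpl]
    nlinarith
  have eq_refl : Set.EqOn F R (segment ℝ p b) := by
    rintro _ ⟨s, t, hs, ht, hst, rfl⟩
    rw [hF]
    split_ifs with h
    · refine (fixed _ (le_antisymm h ?_)).symm
      rw [comb p b s t hst, hpl]
      nlinarith
    · rfl
  have hR' : R = lineReflection q n := funext hR
  rw [segment_eq_union_of_mem hp, Set.image_union, eq_id.image_eq, Set.image_id,
    eq_refl.image_eq]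
  congr 1
  conv_rhs => rw [← fixed p hpl]
  rw [hR', image_segment]
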